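/- Let ℬ be a Markushevich basis of 𝕏 having the FDSP with constant M, fix 0 < s ≤ 1, 0 < t ≤ 1 and m ∈ ℕ, and suppose L₁, L₂ > 0 are such that for every x ∈ 𝕏 there exist A ∈ 𝒢(x,2m,s) and y ∈ 𝕏 with supp(y) ⊆ A and ‖x − y‖ ≤ L₁·σ_{2m}(x), and for every x ∈ 𝕏 there exist A ∈ 𝒢(x,m,s) and y ∈ 𝕏 with supp(y) ⊆ A and ‖x − y‖ ≤ L₂·σ_m(x). Then for every x ∈ 𝕏, every A ∈ 𝒢(x,m,t) and every y ∈ 𝕏 with |supp(y)| ≤ m and supp(y) ∩ A = ∅, one has ‖x − P_A(x)‖ ≤ M·L₁·(1 + 2(M+1)·L₂·t⁻¹s⁻²)·‖x − y‖. In particular, if ℬ is C-s-weak semi-greedy, then ℬ is K-almost greedy for some K ≤ min{M·C·(1 + 2C(M+1)s⁻²), max{M·C·(1 + 6Cs⁻²), 1 + λλ′ + λ″}}. -/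

import Mathlib

open scoped BigOperators ENNReal
open Filter

noncomputable section

namespace GreedyPaper

variable {𝕜 : Type*} [RCLike 𝕜] {X : Type*} [NormedAddCommGroup X] [NormedSpace 𝕜 X]

/-- Support of `x` with respect to the coordinate functionals `f`. -/
def msupp (f : ℕ → X →L[𝕜] 𝕜) (x : X) : Set ℕ := {i | f i x ≠ 0}

/-- Projection onto a finite set of coordinates. -/
def proj (e : ℕ → X) (f : ℕ → X →L[𝕜] 𝕜) (A : Finset ℕ) (x : X) : X :=
  ∑ i ∈ A, f i x • e i

/-- `A` is an `m`-`t`-greedy set for `x`: `|A| = m` and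
`min_{j ∈ A} |f j x| ≥ t · sup_{k ∉ A} |f k x|`. -/
def GreedySet (f : ℕ → X →L[𝕜] 𝕜) (x : X) (m : ℕ) (t : ℝ) (A : Finset ℕ) : Prop :=
  A.card = m ∧ ∀ j ∈ A, ∀ k ∉ A, t * ‖f k x‖ ≤ ‖f j x‖

/-- `w`-measure of a set of indices, with value in `ℝ≥0∞` (possibly infinite). -/
def wsum (w : ℕ → ℝ) (S : Set ℕ) : ℝ≥0∞ := ∑' i : S, ENNReal.ofReal (w i)

/-- Sign of a scalar: `sgn 0 = 1` and `sgn t * t = |t|`. -/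
def sgn (t : 𝕜) : 𝕜 := if t = 0 then 1 else (‖t‖ : 𝕜) / t

/-- A Markushevich basis (with the boundedness assumptions of the paper):
biorthogonality, dense span, totality of the coordinate functionals, and boundedness
of both the basis vectors and the coordinate functionals. -/
structure IsMarkushevichBasis (e : ℕ → X) (f : ℕ → X →L[𝕜] 𝕜) : Prop where
  biorth : ∀ i j, f i (e j) = if i = j then 1 else 0
  dense_span : Dense ((Submodule.span 𝕜 (Set.range e) : Submodule 𝕜 X) : Set X)
  total : ∀ x : X, (∀ i, f i x = 0) → x = 0
  bddE : BddAbove (Set.range fun i => ‖e i‖)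
  bddF : BddAbove (Set.range fun i => ‖f i‖)

/-- `ℬ` is `C`-`s`-`w`-semi-greedy: for every `x` and `m` there are an `m`-`s`-greedy set `A`
and `y` supported in `A` with `‖x - y‖ ≤ C · inf {‖x - z‖ : supp z finite, w(supp z) ≤ w(A)}`. -/
def SemiGreedy (e : ℕ → X) (f : ℕ → X →L[𝕜] 𝕜) (w : ℕ → ℝ) (C s : ℝ) : Prop :=
  ∀ (x : X) (m : ℕ), ∃ A : Finset ℕ, GreedySet f x m s A ∧
    ∃ y : X, msupp f y ⊆ (A : Set ℕ) ∧
      ∀ z : X, (msupp f z).Finite → wsum w (msupp f z) ≤ wsum w (A : Set ℕ) →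
        ‖x - y‖ ≤ C * ‖x - z‖

/-- `ℬ` is `C`-`s`-`w`-almost semi-greedy. -/
def AlmostSemiGreedy (e : ℕ → X) (f : ℕ → X →L[𝕜] 𝕜) (w : ℕ → ℝ) (C s : ℝ) : Prop :=
  ∀ (x : X) (m : ℕ), ∃ A : Finset ℕ, GreedySet f x m s A ∧
    ∃ y : X, msupp f y ⊆ (A : Set ℕ) ∧
      ∀ B : Finset ℕ, wsum w (B : Set ℕ) ≤ wsum w (A : Set ℕ) →
        ‖x - y‖ ≤ C * ‖x - proj e f B x‖

/-- `ℬ` is `C`-`w`-almost greedy. -/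
def AlmostGreedy (e : ℕ → X) (f : ℕ → X →L[𝕜] 𝕜) (w : ℕ → ℝ) (C : ℝ) : Prop :=
  ∀ (x : X) (m : ℕ) (A : Finset ℕ), GreedySet f x m 1 A →
    ∀ B : Finset ℕ, wsum w (B : Set ℕ) ≤ wsum w (A : Set ℕ) →
      ‖x - proj e f A x‖ ≤ C * ‖x - proj e f B x‖

/-- `ℬ` is `C`-`w`-disjoint almost greedy. -/
def DisjointAlmostGreedy (e : ℕ → X) (f : ℕ → X →L[𝕜] 𝕜) (w : ℕ → ℝ) (C : ℝ) : Prop :=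
  ∀ (x : X) (m : ℕ) (A : Finset ℕ), GreedySet f x m 1 A →
    ∀ B : Finset ℕ, wsum w (B : Set ℕ) ≤ wsum w (A : Set ℕ) → Disjoint B A →
      ‖x - proj e f A x‖ ≤ C * ‖x - proj e f B x‖

/-- `ℬ` is `C`-`s`-`w`-almost greedy in the weak sense. -/
def WeakAlmostGreedy (e : ℕ → X) (f : ℕ → X →L[𝕜] 𝕜) (w : ℕ → ℝ) (C s : ℝ) : Prop :=
  ∀ (x : X) (m : ℕ), ∃ A : Finset ℕ, GreedySet f x m s A ∧
    ∀ B : Finset ℕ, wsum w (B : Set ℕ) ≤ wsum w (A : Set ℕ) →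
      ‖x - proj e f A x‖ ≤ C * ‖x - proj e f B x‖

/-- `ℬ` is `C`-`w`-superdemocratic. -/
def SuperDemocratic (e : ℕ → X) (f : ℕ → X →L[𝕜] 𝕜) (w : ℕ → ℝ) (C : ℝ) : Prop :=
  ∀ (A B : Finset ℕ) (ε ε' : ℕ → 𝕜), (∀ i ∈ A, ‖ε i‖ = 1) → (∀ i ∈ B, ‖ε' i‖ = 1) →
    wsum w (A : Set ℕ) ≤ wsum w (B : Set ℕ) →
      ‖∑ i ∈ A, ε i • e i‖ ≤ C * ‖∑ i ∈ B, ε' i • e i‖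

/-- `ℬ` is `C`-`w`-democratic. -/
def Democratic (e : ℕ → X) (f : ℕ → X →L[𝕜] 𝕜) (w : ℕ → ℝ) (C : ℝ) : Prop :=
  ∀ A B : Finset ℕ, wsum w (A : Set ℕ) ≤ wsum w (B : Set ℕ) →
    ‖∑ i ∈ A, e i‖ ≤ C * ‖∑ i ∈ B, e i‖

/-- `ℬ` is `C`-truncation quasi-greedy. -/
def TruncationQuasiGreedy (e : ℕ → X) (f : ℕ → X →L[𝕜] 𝕜) (C : ℝ) : Prop :=
  ∀ (x : X) (m : ℕ) (A : Finset ℕ) (hA : A.Nonempty), GreedySet f x m 1 A →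
    (A.inf' hA fun i => ‖f i x‖) * ‖∑ i ∈ A, sgn (f i x) • e i‖ ≤ C * ‖x‖

/-- `ℬ` has the `C`-`w`-Property (A). -/
def PropertyA (e : ℕ → X) (f : ℕ → X →L[𝕜] 𝕜) (w : ℕ → ℝ) (C : ℝ) : Prop :=
  ∀ x : X, (∀ i, ‖f i x‖ ≤ 1) →
    ∀ A B : Finset ℕ, wsum w (A : Set ℕ) ≤ wsum w (B : Set ℕ) → Disjoint A B →
      (∀ i ∈ A ∪ B, f i x = 0) →
      ∀ ε ε' : ℕ → 𝕜, (∀ i ∈ A, ‖ε i‖ = 1) → (∀ i ∈ B, ‖ε' i‖ = 1) →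
        ‖x + ∑ i ∈ A, ε i • e i‖ ≤ C * ‖x + ∑ i ∈ B, ε' i • e i‖

/-- The finite dimensional separation property (FDSP) with constant `M`. -/
def FDSP (e : ℕ → X) (M : ℝ) : Prop :=
  ∀ Z : Submodule 𝕜 X, IsClosed (Z : Set X) → TopologicalSpace.IsSeparable (Z : Set X) →
    ∀ ε : ℝ, 0 < ε → ∃ k : ℕ → ℕ, StrictMono k ∧
      (∀ (a : ℕ → 𝕜) (n l : ℕ), n ≤ l →
        ‖∑ j ∈ Finset.range (n + 1), a j • e (k j)‖ ≤
          (M + ε) * ‖∑ j ∈ Finset.range (l + 1), a j • e (k j)‖) ∧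
      (∀ F : Submodule 𝕜 X, F ≤ Z → FiniteDimensional 𝕜 F →
        ∃ N : ℕ, ∀ x ∈ F,
          ∀ z ∈ closure ((Submodule.span 𝕜 {v : X | ∃ n, N < n ∧ v = e (k n)} :
              Submodule 𝕜 X) : Set X),
            ‖x‖ ≤ (M + ε) * ‖x + z‖)

/-- `v` is a block basis of `e`. -/
def IsBlockBasis (e v : ℕ → X) : Prop :=
  ∃ (b : ℕ → 𝕜) (n m : ℕ → ℕ), (∀ i, n i ≤ m i) ∧ (∀ i, m i < n (i + 1)) ∧
    (∀ i, v i = ∑ k ∈ Finset.Icc (n i) (m i), b k • e k) ∧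
    (∀ i, ∃ k ∈ Finset.Icc (n i) (m i), b k ≠ 0)

section Auxiliary

variable {e : ℕ → X} {f : ℕ → X →L[𝕜] 𝕜}

/-- Every `x` is approximated, up to the factor `L`, as well by a vector supported on one of its
`m`-`s`-greedy sets as by any vector with at most `m` nonzero coordinates. -/
def WeakSemiGreedyAt (f : ℕ → X →L[𝕜] 𝕜) (s : ℝ) (m : ℕ) (L : ℝ) : Prop :=
  ∀ x : X, ∃ A : Finset ℕ, GreedySet f x m s A ∧
    ∃ y : X, msupp f y ⊆ (A : Set ℕ) ∧
      ∀ z : X, (msupp f z).Finite → (msupp f z).ncard ≤ m → ‖x - y‖ ≤ L * ‖x - z‖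

/-- The tails of `(e (k n))` are separated with constant `c` from every finite dimensional
subspace. -/
def Separates (𝕜 : Type*) [RCLike 𝕜] {X : Type*} [NormedAddCommGroup X] [NormedSpace 𝕜 X]
    (e : ℕ → X) (k : ℕ → ℕ) (c : ℝ) : Prop :=
  ∀ F : Submodule 𝕜 X, FiniteDimensional 𝕜 F → ∃ N : ℕ, ∀ x ∈ F,
    ∀ z ∈ Submodule.span 𝕜 {v : X | ∃ n, N < n ∧ v = e (k n)}, ‖x‖ ≤ c * ‖x + z‖

/-- Arbitrarily far along `k` there are unimodular sums of `p` basis vectors whose norm, scaled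
by `α`, is at most `H`. -/
def FarBound (𝕜 : Type*) [RCLike 𝕜] {X : Type*} [NormedAddCommGroup X] [NormedSpace 𝕜 X]
    (e : ℕ → X) (k : ℕ → ℕ) (α : ℝ) (p : ℕ) (H : ℝ) : Prop :=
  ∀ N : ℕ, ∃ (D : Finset ℕ) (η : ℕ → 𝕜), D.card = p ∧ (∀ i ∈ D, ∃ n, N < n ∧ i = k n) ∧
    (∀ i ∈ D, ‖η i‖ = 1) ∧ α * ‖∑ i ∈ D, η i • e i‖ ≤ H

theorem IsMarkushevichBasis.coord_sum (hb : IsMarkushevichBasis e f) (D : Finset ℕ) (a : ℕ → 𝕜)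
    (i : ℕ) : f i (∑ j ∈ D, a j • e j) = if i ∈ D then a i else 0 := by
  simp [map_sum, hb.biorth]

theorem IsMarkushevichBasis.coord_proj (hb : IsMarkushevichBasis e f) (A : Finset ℕ) (x : X)
    (i : ℕ) : f i (proj e f A x) = if i ∈ A then f i x else 0 :=
  hb.coord_sum A (fun j => f j x) i

theorem IsMarkushevichBasis.ext (hb : IsMarkushevichBasis e f) {x y : X}
    (h : ∀ i, f i x = f i y) : x = y :=
  sub_eq_zero.mp (hb.total _ fun i => by rw [map_sub, h i, sub_self])

theorem IsMarkushevichBasis.proj_eq_self (hb : IsMarkushevichBasis e f) {y : X} {B : Finset ℕ}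
    (h : msupp f y ⊆ (B : Set ℕ)) : proj e f B y = y := by
  refine hb.ext fun i => ?_
  rw [hb.coord_proj]
  split_ifs with hi
  · rfl
  · by_contra h0
    exact hi (h (fun h1 => h0 h1.symm))

theorem IsMarkushevichBasis.ne_zero (hb : IsMarkushevichBasis e f) (i : ℕ) : e i ≠ 0 := by
  intro h
  have := hb.biorth i i
  simp [h] at this

theorem IsMarkushevichBasis.exists_norm_coord_lt (hb : IsMarkushevichBasis e f) (x : X) {δ : ℝ}
    (hδ : 0 < δ) : ∃ N : ℕ, ∀ i, N ≤ i → ‖f i x‖ < δ := by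
  obtain ⟨Λ, hΛ⟩ := hb.bddF
  have hΛ' : ∀ i, ‖f i‖ ≤ Λ := fun i => hΛ ⟨i, rfl⟩
  have hΛ0 : 0 ≤ Λ := (norm_nonneg _).trans (hΛ' 0)
  obtain ⟨z, hz, hxz⟩ := Metric.mem_closure_iff.mp (hb.dense_span x) (δ / (Λ + 1)) (by positivity)
  have hzN : ∃ N : ℕ, ∀ i, N ≤ i → f i z = 0 := by
    clear hxz
    induction hz using Submodule.span_induction with
    | mem v hv =>
      obtain ⟨j, rfl⟩ := hv
      exact ⟨j + 1, fun i hi => by rw [hb.biorth, if_neg (by omega)]⟩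
    | zero => exact ⟨0, fun i _ => map_zero _⟩
    | add u v _ _ hu hv =>
      obtain ⟨N₁, h₁⟩ := hu
      obtain ⟨N₂, h₂⟩ := hv
      exact ⟨max N₁ N₂, fun i hi => by
        rw [map_add, h₁ i (le_of_max_le_left hi), h₂ i (le_of_max_le_right hi), add_zero]⟩
    | smul a v _ hv =>
      obtain ⟨N, h⟩ := hv
      exact ⟨N, fun i hi => by rw [map_smul, h i hi, smul_zero]⟩
  obtain ⟨N, hN⟩ := hzN
  refine ⟨N, fun i hi => ?_⟩
  have h1 : f i x = f i (x - z) := by rw [map_sub, hN i hi, sub_zero]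
  rw [h1]
  rw [dist_eq_norm, lt_div_iff₀ (by positivity)] at hxz
  calc ‖f i (x - z)‖ ≤ ‖f i‖ * ‖x - z‖ := (f i).le_opNorm _
    _ ≤ Λ * ‖x - z‖ := by gcongr; exact hΛ' i
    _ ≤ ‖x - z‖ * (Λ + 1) := by nlinarith [norm_nonneg (x - z)]
    _ < δ := hxz

theorem FDSP.exists_separates {M : ℝ} (hfdsp : FDSP (𝕜 := 𝕜) e M)
    (hb : IsMarkushevichBasis e f) {ε : ℝ} (hε : 0 < ε) :
    1 ≤ M + ε ∧ ∃ k : ℕ → ℕ, StrictMono k ∧ Separates 𝕜 e k (M + ε) := by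
  have hsep : TopologicalSpace.IsSeparable ((⊤ : Submodule 𝕜 X) : Set X) := by
    have h := ((Set.countable_range e).isSeparable.span (R := 𝕜)).closure
    rwa [hb.dense_span.closure_eq] at h
  obtain ⟨k, hk, hbasic, hF⟩ := hfdsp ⊤ isClosed_univ hsep ε hε
  refine ⟨?_, k, hk, fun F hFfin => ?_⟩
  · have h := hbasic (fun _ => 1) 0 0 le_rfl
    simp only [zero_add, Finset.sum_range_one, one_smul] at h
    have hpos : 0 < ‖e (k 0)‖ := norm_pos_iff.mpr (hb.ne_zero _)
    exact le_of_mul_le_mul_right (by rwa [one_mul]) hpos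
  · obtain ⟨N, hN⟩ := hF F le_top hFfin
    exact ⟨N, fun x hx z hz => hN x hx z (subset_closure hz)⟩

theorem FDSP.one_le {M : ℝ} (hfdsp : FDSP (𝕜 := 𝕜) e M) (hb : IsMarkushevichBasis e f) :
    1 ≤ M :=
  le_of_forall_pos_le_add fun _ hε => (hfdsp.exists_separates hb hε).1

theorem FarBound.add {k : ℕ → ℕ} (hk : StrictMono k) {α : ℝ} (hα : 0 ≤ α) {p q : ℕ} {H H' : ℝ}
    (hp : FarBound 𝕜 e k α p H) (hq : FarBound 𝕜 e k α q H') :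
    FarBound 𝕜 e k α (p + q) (H + H') := by
  intro N
  obtain ⟨D, η, hD, hDk, hη, hDH⟩ := hp N
  obtain ⟨D', η', hD', hDk', hη', hDH'⟩ := hq (max N (D.sup id))
  have hdisj : Disjoint D D' := by
    rw [Finset.disjoint_left]
    intro i hi hi'
    obtain ⟨n, hn, rfl⟩ := hDk' i hi'
    have h1 : k n ≤ D.sup id := Finset.le_sup (f := id) hi
    have h2 := hk.id_le n
    have h3 := (le_max_right N (D.sup id))
    simp only [id_eq] at h2
    omega
  have hsum : ∑ i ∈ D ∪ D', (if i ∈ D then η i else η' i) • e i =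
      ∑ i ∈ D, η i • e i + ∑ i ∈ D', η' i • e i := by
    rw [Finset.sum_union hdisj]
    congr 1
    · exact Finset.sum_congr rfl fun i hi => by rw [if_pos hi]
    · exact Finset.sum_congr rfl fun i hi => by rw [if_neg (Finset.disjoint_right.mp hdisj hi)]
  refine ⟨D ∪ D', fun i => if i ∈ D then η i else η' i, ?_, ?_, ?_, ?_⟩
  · rw [Finset.card_union_of_disjoint hdisj, hD, hD']
  · intro i hi
    rcases Finset.mem_union.mp hi with h | h
    · exact hDk i h
    · obtain ⟨n, hn, h⟩ := hDk' i h
      exact ⟨n, (le_max_left _ _).trans_lt hn, h⟩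
  · intro i hi
    dsimp only
    split_ifs with h
    · exact hη i h
    · exact hη' i ((Finset.mem_union.mp hi).resolve_left h)
  · rw [hsum]
    calc α * ‖∑ i ∈ D, η i • e i + ∑ i ∈ D', η' i • e i‖
        ≤ α * (‖∑ i ∈ D, η i • e i‖ + ‖∑ i ∈ D', η' i • e i‖) := by
          gcongr; exact norm_add_le _ _
      _ ≤ H + H' := by linarith

/-- If `x` has small coordinates off a greedy set `A`, adding a large far unimodular sum forces the
greedy sets of the perturbation to be far away. -/
theorem norm_sub_proj_le_of_farBound (hb : IsMarkushevichBasis e f) {s t : ℝ} (hs0 : 0 < s)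
    (ht0 : 0 < t) {m : ℕ} {L : ℝ} (hL : 0 < L)
    (happrox : WeakSemiGreedyAt f s (2 * m) L) {x : X} {A : Finset ℕ} (hA : A.card = m) {α : ℝ}
    (hα : 0 < α) (hxA : ∀ i ∉ A, t * ‖f i x‖ ≤ α) {y : X} (hy : (msupp f y).Finite)
    (hym : (msupp f y).ncard ≤ m) {k : ℕ → ℕ} (hk : StrictMono k) {c : ℝ} (hc : 0 ≤ c)
    (hsep : Separates 𝕜 e k c) {ε : ℝ} (hε : 0 < ε) {H : ℝ}
    (hH : FarBound 𝕜 e k α (2 * m) H) :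
    ‖x - proj e f A x‖ ≤ c * L * (‖x - y‖ + (1 + ε) / (t * s) * H) := by
  set u := x - proj e f A x with hu
  set γ := α / (t * s) * (1 + ε) with hγ
  have hγ0 : 0 < γ := by positivity
  obtain ⟨N₁, hN₁⟩ := hb.exists_norm_coord_lt u (δ := α / (t * s) * ε) (by positivity)
  obtain ⟨N₂, hN₂⟩ := hsep (Submodule.span 𝕜 {u}) inferInstance
  obtain ⟨D, η, hD, hDk, hη, hDH⟩ := hH (max N₁ N₂)
  have hDN : ∀ i ∈ D, N₁ ≤ i := by
    intro i hi
    obtain ⟨n, hn, rfl⟩ := hDk i hi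
    have h2 := hk.id_le n
    have h3 := le_max_left N₁ N₂
    simp only [id_eq] at h2
    omega
  set d := ∑ i ∈ D, η i • e i with hd
  have hfu : ∀ i, t * ‖f i u‖ ≤ α := by
    intro i
    rw [hu, map_sub, hb.coord_proj]
    split_ifs with h
    · simpa using hα.le
    · simpa using hxA i h
  set v := u + (γ : 𝕜) • d with hv
  have hfv : ∀ i, f i v = f i u + (γ : 𝕜) * (if i ∈ D then η i else 0) := by
    intro i
    rw [hv, map_add, map_smul, hd, hb.coord_sum, smul_eq_mul]
  have hfvD : ∀ i ∈ D, α / (t * s) < ‖f i v‖ := by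
    intro i hi
    have h1 := hN₁ i (hDN i hi)
    have h2 : ‖(γ : 𝕜) * η i‖ = γ := by
      rw [norm_mul, hη i hi, mul_one, RCLike.norm_ofReal, abs_of_pos hγ0]
    have h3 : ‖(γ : 𝕜) * η i‖ ≤ ‖f i v‖ + ‖f i u‖ := by
      have : (γ : 𝕜) * η i = f i v - f i u := by rw [hfv, if_pos hi]; ring
      rw [this]; exact norm_sub_le _ _
    have h4 : γ = α / (t * s) + α / (t * s) * ε := by rw [hγ]; ring
    linarith
  obtain ⟨B, ⟨hBcard, hBgr⟩, y', hy'B, hy'⟩ := happrox v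
  have hBD : B = D := by
    refine Finset.eq_of_subset_of_card_le (fun j hj => ?_) (by omega)
    by_contra hjD
    obtain ⟨i, hi, hiB⟩ : ∃ i ∈ D, i ∉ B := by
      by_contra! hcon
      exact hjD (Finset.eq_of_subset_of_card_le hcon (by omega) ▸ hj)
    have h1 := hBgr j hj i hiB
    have h2 : f j v = f j u := by rw [hfv, if_neg hjD]; ring
    rw [h2] at h1
    have h3 := hfvD i hi
    have h4 := hfu j
    have h5 : s * (α / (t * s)) < s * ‖f i v‖ := by gcongr
    have h6 : t * (s * (α / (t * s))) = α := by field_simp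
    nlinarith
  subst hBD
  have hy'sum : y' = ∑ i ∈ B, f i y' • e i := (hb.proj_eq_self hy'B).symm
  have hspan : ∀ a : ℕ → 𝕜, ∑ i ∈ B, a i • e i ∈
      Submodule.span 𝕜 {v : X | ∃ n, N₂ < n ∧ v = e (k n)} := by
    intro a
    refine Submodule.sum_mem _ fun i hi => Submodule.smul_mem _ _ (Submodule.subset_span ?_)
    obtain ⟨n, hn, rfl⟩ := hDk i hi
    exact ⟨n, (le_max_right _ _).trans_lt hn, rfl⟩
  have h1 : ‖u‖ ≤ c * ‖u + ((γ : 𝕜) • d - y')‖ := by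
    refine hN₂ u (Submodule.mem_span_singleton_self u) _ (Submodule.sub_mem _ ?_ ?_)
    · exact Submodule.smul_mem _ _ (hspan η)
    · rw [hy'sum]; exact hspan _
  have hsub : msupp f (y - proj e f A x) ⊆ msupp f y ∪ (A : Set ℕ) := by
    intro i hi
    by_contra hcon
    simp only [Set.mem_union, not_or, msupp, Set.mem_ofPred_eq, not_not, Finset.mem_coe] at hcon
    apply hi
    rw [map_sub, hb.coord_proj, if_neg hcon.2, hcon.1, sub_zero]
  have hfin : (msupp f y ∪ (A : Set ℕ)).Finite := hy.union A.finite_toSet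
  have h2 : ‖v - y'‖ ≤ L * ‖v - (y - proj e f A x)‖ := by
    refine hy' _ (hfin.subset hsub) ?_
    calc _ ≤ (msupp f y ∪ (A : Set ℕ)).ncard := Set.ncard_le_ncard hsub hfin
      _ ≤ (msupp f y).ncard + (A : Set ℕ).ncard := Set.ncard_union_le _ _
      _ ≤ 2 * m := by rw [Set.ncard_coe_finset]; omega
  have h3 : v - (y - proj e f A x) = (x - y) + (γ : 𝕜) • d := by rw [hv, hu]; abel
  have h4 : ‖(γ : 𝕜) • d‖ ≤ (1 + ε) / (t * s) * H := by
    rw [norm_smul, RCLike.norm_ofReal, abs_of_pos hγ0]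
    calc γ * ‖d‖ = (1 + ε) / (t * s) * (α * ‖d‖) := by rw [hγ]; ring
      _ ≤ _ := by gcongr
  have h5 : u + ((γ : 𝕜) • d - y') = v - y' := by rw [hv]; abel
  rw [h5] at h1
  calc ‖u‖ ≤ c * ‖v - y'‖ := h1
    _ ≤ c * (L * ‖v - (y - proj e f A x)‖) := by gcongr
    _ ≤ c * (L * (‖x - y‖ + (1 + ε) / (t * s) * H)) := by
        rw [h3]; gcongr; exact (norm_add_le _ _).trans (by gcongr)
    _ = _ := by ring

/-- A small far unimodular sum added to `w` does not affect the location of weak greedy sets. -/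
theorem exists_approx_add_far (hb : IsMarkushevichBasis e f) {s : ℝ} (hs0 : 0 < s)
    {m : ℕ} {L : ℝ} (happrox : WeakSemiGreedyAt f s m L) {w : X} {A : Finset ℕ}
    (hA : A.card = m) {α : ℝ} (hwA : ∀ i ∈ A, α ≤ ‖f i w‖) {β : ℝ} (hβ0 : 0 ≤ β)
    (hβ : β < s * α) :
    ∃ (G : Finset ℕ) (N : ℕ), ∀ (D : Finset ℕ) (η : ℕ → 𝕜), D.card ≤ m → (∀ i ∈ D, N ≤ i) →
      (∀ i ∈ D, ‖η i‖ = 1) → ∃ y' ∈ Submodule.span 𝕜 (e '' (G : Set ℕ)),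
        ‖w - y' + (β : 𝕜) • ∑ i ∈ D, η i • e i‖ ≤ L * ‖w‖ := by
  obtain ⟨N₁, hN₁⟩ := hb.exists_norm_coord_lt w (δ := s * α - β) (by linarith)
  refine ⟨A ∪ Finset.range N₁, max N₁ (A.sup id + 1), fun D η hD hDN hη => ?_⟩
  have hDA : ∀ i ∈ A, i ∉ D := by
    intro i hi hiD
    have h1 := hDN i hiD
    have h2 : i ≤ A.sup id := Finset.le_sup (f := id) hi
    have h3 := le_max_right N₁ (A.sup id + 1)
    omega
  set d := ∑ i ∈ D, η i • e i with hd
  set v := w + (β : 𝕜) • d with hv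
  have hfd : ∀ i, f i ((β : 𝕜) • d) = (β : 𝕜) * (if i ∈ D then η i else 0) := by
    intro i
    rw [map_smul, hd, hb.coord_sum, smul_eq_mul]
  have hfv : ∀ i, f i v = f i w + (β : 𝕜) * (if i ∈ D then η i else 0) := by
    intro i
    rw [hv, map_add, hfd]
  obtain ⟨B, ⟨hBcard, hBgr⟩, y', hy'B, hy'⟩ := happrox v
  have hBG : B ⊆ A ∪ Finset.range N₁ := by
    intro j hj
    by_cases hjA : j ∈ A
    · exact Finset.mem_union_left _ hjA
    obtain ⟨i, hi, hiB⟩ : ∃ i ∈ A, i ∉ B := by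
      by_contra! hcon
      exact hjA (Finset.eq_of_subset_of_card_le hcon (by omega) ▸ hj)
    have h1 := hBgr j hj i hiB
    have h2 : f i v = f i w := by rw [hfv, if_neg (hDA i hi)]; ring
    rw [h2] at h1
    have h3 : s * α ≤ s * ‖f i w‖ := by gcongr; exact hwA i hi
    have h4 : ‖f j v‖ ≤ ‖f j w‖ + β := by
      rw [hfv]
      refine (norm_add_le _ _).trans ?_
      gcongr
      rw [norm_mul, RCLike.norm_ofReal, abs_of_nonneg hβ0]
      split_ifs with h
      · rw [hη j h, mul_one]
      · simpa using hβ0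
    refine Finset.mem_union_right _ (Finset.mem_range.mpr ?_)
    by_contra! hcon
    have := hN₁ j hcon
    linarith
  refine ⟨y', ?_, ?_⟩
  · rw [← hb.proj_eq_self hy'B]
    exact Submodule.sum_mem _ fun i hi => Submodule.smul_mem _ _
      (Submodule.subset_span ⟨i, hBG hi, rfl⟩)
  · have hsub : msupp f ((β : 𝕜) • d) ⊆ (D : Set ℕ) := by
      intro i hi
      by_contra hcon
      apply hi
      rw [hfd, if_neg (by simpa using hcon), mul_zero]
    have h := hy' ((β : 𝕜) • d) (D.finite_toSet.subset hsub)
      ((Set.ncard_le_ncard hsub D.finite_toSet).trans (by rwa [Set.ncard_coe_finset]))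
    have h1 : v - (β : 𝕜) • d = w := by rw [hv]; abel
    have h2 : w - y' + (β : 𝕜) • d = v - y' := by rw [hv]; abel
    rwa [h1, ← h2] at h

theorem exists_far_image {k : ℕ → ℕ} (hk : StrictMono k) (N p : ℕ) :
    ∃ D : Finset ℕ, D.card = p ∧ ∀ i ∈ D, ∃ n, N < n ∧ i = k n := by
  refine ⟨(Finset.Ioc N (N + p)).image k, ?_, fun i hi => ?_⟩
  · rw [Finset.card_image_of_injective _ hk.injective, Nat.card_Ioc]; omega
  · obtain ⟨n, hn, rfl⟩ := Finset.mem_image.mp hi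
    exact ⟨n, (Finset.mem_Ioc.mp hn).1, rfl⟩

theorem farBound_of_separates (hb : IsMarkushevichBasis e f) {s : ℝ} (hs0 : 0 < s)
    {m : ℕ} {L : ℝ} (happrox : WeakSemiGreedyAt f s m L) {w : X} {A : Finset ℕ}
    (hA : A.card = m) {α : ℝ} (hα : 0 < α) (hwA : ∀ i ∈ A, α ≤ ‖f i w‖) {k : ℕ → ℕ}
    (hk : StrictMono k) {c : ℝ} (hc : 0 ≤ c) (hsep : Separates 𝕜 e k c) {ε : ℝ} (hε : 0 < ε) :
    FarBound 𝕜 e k α m ((1 + ε) / s * ((1 + c) * (L * ‖w‖))) := by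
  intro N
  set β := s * α / (1 + ε) with hβdef
  have hβ0 : 0 < β := by positivity
  have hβ : β < s * α := div_lt_self (by positivity) (by linarith)
  obtain ⟨G, N₁, hG⟩ := exists_approx_add_far hb hs0 happrox hA hwA hβ0.le hβ
  have : FiniteDimensional 𝕜 (Submodule.span 𝕜 (e '' (G : Set ℕ) ∪ {w})) :=
    FiniteDimensional.span_of_finite 𝕜
      ((G.finite_toSet.image e).union (Set.finite_singleton w))
  obtain ⟨N₂, hN₂⟩ := hsep _ this
  obtain ⟨D, hD, hDk⟩ := exists_far_image hk (max N (max N₁ N₂)) m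
  have hDk' : ∀ i ∈ D, N ≤ i ∧ N₁ ≤ i ∧ ∃ n, N < n ∧ N₂ < n ∧ i = k n := by
    intro i hi
    obtain ⟨n, hn, rfl⟩ := hDk i hi
    have h2 := hk.id_le n
    simp only [max_lt_iff, id_eq] at hn h2
    exact ⟨by omega, by omega, n, by omega, by omega, rfl⟩
  obtain ⟨y', hy', hle⟩ := hG D (fun _ => 1) hD.le (fun i hi => (hDk' i hi).2.1)
    (fun _ _ => norm_one)
  refine ⟨D, fun _ => 1, hD, fun i hi => ?_, fun _ _ => norm_one, ?_⟩
  · obtain ⟨n, h1, -, h2⟩ := (hDk' i hi).2.2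
    exact ⟨n, h1, h2⟩
  set d := ∑ i ∈ D, (1 : 𝕜) • e i with hd
  have h1 : ‖w - y'‖ ≤ c * ‖w - y' + (β : 𝕜) • d‖ := by
    refine hN₂ _ (Submodule.sub_mem _ (Submodule.subset_span (Or.inr rfl))
      (Submodule.span_mono Set.subset_union_left hy')) _ (Submodule.smul_mem _ _ ?_)
    refine Submodule.sum_mem _ fun i hi => Submodule.smul_mem _ _ (Submodule.subset_span ?_)
    obtain ⟨n, -, h1, rfl⟩ := (hDk' i hi).2.2
    exact ⟨n, h1, rfl⟩
  have h2 : ‖(β : 𝕜) • d‖ ≤ ‖w - y' + (β : 𝕜) • d‖ + ‖w - y'‖ := by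
    have h := norm_sub_le (w - y' + (β : 𝕜) • d) (w - y')
    rwa [add_sub_cancel_left] at h
  rw [norm_smul, RCLike.norm_ofReal, abs_of_pos hβ0] at h2
  have h3 : β * ‖d‖ ≤ (1 + c) * (L * ‖w‖) := by nlinarith
  calc α * ‖d‖ = (1 + ε) / s * (β * ‖d‖) := by rw [hβdef]; field_simp
    _ ≤ _ := by gcongr

/-- Averaging along a path makes differences `g i - g j` negligible, so they are asymptotically
separated from any compact set with constant one. -/
theorem exists_norm_sub_le_of_compact (𝕜 : Type*) [RCLike 𝕜] {X : Type*}
    [NormedAddCommGroup X] [NormedSpace 𝕜 X] {S : Set X} (hS : IsCompact S) (w : X) {g : ℕ → X}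
    {Γ R : ℝ} (hg : ∀ i, ‖g i‖ ≤ Γ) {y : ℕ → ℕ → X} (hyS : ∀ i j, i < j → y i j ∈ S)
    (hy : ∀ i j, i < j → ‖w - y i j + (g i - g j)‖ ≤ R) {ε : ℝ} (hε : 0 < ε) :
    ∃ i j, i < j ∧ ‖g i - g j‖ ≤ 2 * R + ε := by
  let U : Ultrafilter ℕ := hyperfilter ℕ
  have hgt : ∀ i : ℕ, ∀ᶠ j in (U : Filter ℕ), i < j := fun i =>
    Nat.hyperfilter_le_atTop (eventually_gt_atTop i)
  have hlim : ∀ i, ∃ z ∈ S, Tendsto (y i) U (nhds z) := by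
    intro i
    obtain ⟨z, hz, hle⟩ := hS.ultrafilter_le_nhds (U.map (y i))
      (le_principal_iff.mpr ((hgt i).mono fun j hj => hyS i j hj))
    exact ⟨z, hz, hle⟩
  choose z hzS hz using hlim
  obtain ⟨z₀, -, hz₀⟩ := hS.ultrafilter_le_nhds (U.map z)
    (le_principal_iff.mpr (mem_map.mpr (Eventually.of_forall hzS)))
  have hz₀' : Tendsto z U (nhds z₀) := hz₀
  set δ := ε / 8 with hδ
  have hδ0 : 0 < δ := by positivity
  have hnear : ∀ᶠ i in (U : Filter ℕ), ‖z i - z₀‖ < δ := by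
    simpa [dist_eq_norm] using Metric.tendsto_nhds.mp hz₀' δ hδ0
  have hnext : ∀ i, ∃ j, i < j ∧ ‖z j - z₀‖ < δ ∧ ‖y i j - z i‖ < δ := by
    intro i
    have h : ∀ᶠ j in (U : Filter ℕ), ‖y i j - z i‖ < δ := by
      simpa [dist_eq_norm] using Metric.tendsto_nhds.mp (hz i) δ hδ0
    exact ((hgt i).and (hnear.and h)).exists
  obtain ⟨i₀, hi₀⟩ := hnear.exists
  choose nx hnx hnxz hnxy using hnext
  let path : ℕ → ℕ := fun n => nx^[n] i₀
  have hpath : ∀ n, path (n + 1) = nx (path n) := fun n => Function.iterate_succ_apply' nx n i₀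
  have hpz : ∀ n, ‖z (path n) - z₀‖ < δ := by
    intro n
    cases n with
    | zero => exact hi₀
    | succ n => rw [hpath]; exact hnxz _
  have hstep : ∀ n, path n < path (n + 1) ∧ ‖y (path n) (path (n + 1)) - z₀‖ ≤ 2 * δ := by
    intro n
    rw [hpath]
    refine ⟨hnx _, ?_⟩
    have h := norm_add_le (y (path n) (nx (path n)) - z (path n)) (z (path n) - z₀)
    rw [sub_add_sub_cancel] at h
    linarith [hnxy (path n), hpz n]
  have hstep' : ∀ n, ‖w - z₀ + (g (path n) - g (path (n + 1)))‖ ≤ R + 2 * δ := by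
    intro n
    have h := norm_add_le (w - y (path n) (path (n + 1)) + (g (path n) - g (path (n + 1))))
      (y (path n) (path (n + 1)) - z₀)
    have heq : w - y (path n) (path (n + 1)) + (g (path n) - g (path (n + 1))) +
      (y (path n) (path (n + 1)) - z₀) = w - z₀ + (g (path n) - g (path (n + 1))) := by abel
    rw [heq] at h
    linarith [hy _ _ (hstep n).1, (hstep n).2]
  have hsum : ∀ n : ℕ, ‖n • (w - z₀) + (g (path 0) - g (path n))‖ ≤ n * (R + 2 * δ) := by
    intro n
    induction n with
    | zero => simp
    | succ n ih =>
      have heq : (n + 1) • (w - z₀) + (g (path 0) - g (path (n + 1))) =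
        (n • (w - z₀) + (g (path 0) - g (path n))) +
          (w - z₀ + (g (path n) - g (path (n + 1)))) := by
        rw [add_smul, one_smul]; abel
      rw [heq]
      push_cast
      linarith [norm_add_le (n • (w - z₀) + (g (path 0) - g (path n)))
        (w - z₀ + (g (path n) - g (path (n + 1)))), hstep' n]
  have hwz : ‖w - z₀‖ ≤ R + 3 * δ := by
    obtain ⟨n, hn⟩ := exists_nat_gt (2 * Γ / δ)
    have hΓ : 0 ≤ Γ := (norm_nonneg _).trans (hg 0)
    have hn0 : (0 : ℝ) < n := lt_of_le_of_lt (by positivity) hn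
    have h1 : ‖n • (w - z₀)‖ ≤ n * (R + 2 * δ) + 2 * Γ := by
      have h := norm_sub_le (n • (w - z₀) + (g (path 0) - g (path n))) (g (path 0) - g (path n))
      rw [add_sub_cancel_right] at h
      linarith [hsum n, norm_sub_le (g (path 0)) (g (path n)), hg (path 0), hg (path n)]
    have h2 : ‖n • (w - z₀)‖ = n * ‖w - z₀‖ := by
      rw [← Nat.cast_smul_eq_nsmul 𝕜, norm_smul, RCLike.norm_natCast]
    rw [div_lt_iff₀ hδ0] at hn
    rw [h2] at h1
    refine le_of_mul_le_mul_left ?_ hn0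
    linarith
  refine ⟨path 0, path 1, (hstep 0).1, ?_⟩
  have h := norm_sub_le (w - z₀ + (g (path 0) - g (path 1))) (w - z₀)
  rw [add_sub_cancel_left] at h
  linarith [hstep' 0]

theorem farBound_of_even (hb : IsMarkushevichBasis e f) {s : ℝ} (hs0 : 0 < s)
    {m : ℕ} {L : ℝ} (happrox : WeakSemiGreedyAt f s m L) {w : X} {A : Finset ℕ}
    (hA : A.card = m) {α : ℝ} (hα : 0 < α) (hwA : ∀ i ∈ A, α ≤ ‖f i w‖) {k : ℕ → ℕ}
    (hk : StrictMono k) {ε : ℝ} (hε : 0 < ε) {q : ℕ} (hq : 2 * q ≤ m) :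
    FarBound 𝕜 e k α (2 * q) ((1 + ε) / s * (2 * (L * ‖w‖) + ε)) := by
  intro N
  set β := s * α / (1 + ε) with hβdef
  have hβ0 : 0 < β := by positivity
  have hβ : β < s * α := div_lt_self (by positivity) (by linarith)
  obtain ⟨G, N₁, hG⟩ := exists_approx_add_far hb hs0 happrox hA hwA hβ0.le hβ
  obtain ⟨Λ, hΛ⟩ := hb.bddE
  have hΛ' : ∀ i, ‖e i‖ ≤ Λ := fun i => hΛ ⟨i, rfl⟩
  let E : ℕ → Finset ℕ := fun i =>
    (Finset.Ioc (N + N₁ + q * i) (N + N₁ + q * i + q)).image k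
  have hEcard : ∀ i, (E i).card = q := fun i => by
    rw [Finset.card_image_of_injective _ hk.injective, Nat.card_Ioc]; omega
  have hEk : ∀ i, ∀ l ∈ E i, ∃ n, N + N₁ < n ∧ l = k n := by
    intro i l hl
    obtain ⟨n, hn, rfl⟩ := Finset.mem_image.mp hl
    exact ⟨n, by have := (Finset.mem_Ioc.mp hn).1; omega, rfl⟩
  have hEdisj : ∀ i j, i < j → Disjoint (E i) (E j) := by
    intro i j hij
    rw [Finset.disjoint_image hk.injective, Finset.disjoint_left]
    intro n hn hn'
    rw [Finset.mem_Ioc] at hn hn'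
    have : q * (i + 1) ≤ q * j := Nat.mul_le_mul_left q hij
    rw [mul_add] at this
    omega
  let η : ℕ → ℕ → 𝕜 := fun i l => if l ∈ E i then 1 else -1
  have hη : ∀ i l, ‖η i l‖ = 1 := fun i l => by dsimp only [η]; split_ifs <;> simp
  let g : ℕ → X := fun i => (β : 𝕜) • ∑ l ∈ E i, e l
  have hsum : ∀ i j, i < j → (β : 𝕜) • ∑ l ∈ E i ∪ E j, η i l • e l = g i - g j := by
    intro i j hij
    rw [Finset.sum_union (hEdisj i j hij), smul_add, sub_eq_add_neg, ← smul_neg,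
      ← Finset.sum_neg_distrib]
    congr 2
    · exact Finset.sum_congr rfl fun l hl => by simp only [η, if_pos hl, one_smul]
    · exact Finset.sum_congr rfl fun l hl => by
        simp only [η, if_neg (Finset.disjoint_right.mp (hEdisj i j hij) hl), neg_smul, one_smul]
  have hcard : ∀ i j, i < j → (E i ∪ E j).card = 2 * q := fun i j hij => by
    rw [Finset.card_union_of_disjoint (hEdisj i j hij), hEcard, hEcard]; ring
  have hDk : ∀ i j, ∀ l ∈ E i ∪ E j, ∃ n, N + N₁ < n ∧ l = k n := by
    intro i j l hl
    rcases Finset.mem_union.mp hl with h | h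
    · exact hEk i l h
    · exact hEk j l h
  have hex : ∀ i j, ∃ y' : X, i < j → y' ∈ Submodule.span 𝕜 (e '' (G : Set ℕ)) ∧
      ‖w - y' + (g i - g j)‖ ≤ L * ‖w‖ := by
    intro i j
    by_cases hij : i < j
    · obtain ⟨y', h1, h2⟩ := hG (E i ∪ E j) (η i) ((hcard i j hij).le.trans hq)
        (fun l hl => by
          obtain ⟨n, hn, rfl⟩ := hDk i j l hl
          have h2 := hk.id_le n
          simp only [id_eq] at h2
          omega) (fun l _ => hη i l)
      rw [hsum i j hij] at h2
      exact ⟨y', fun _ => ⟨h1, h2⟩⟩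
    · exact ⟨0, fun h => absurd h hij⟩
  choose y hy using hex
  have hgb : ∀ i, ‖g i‖ ≤ β * (q * Λ) := by
    intro i
    rw [norm_smul, RCLike.norm_ofReal, abs_of_pos hβ0]
    gcongr
    calc ‖∑ l ∈ E i, e l‖ ≤ ∑ l ∈ E i, ‖e l‖ := norm_sum_le _ _
      _ ≤ (E i).card • Λ := Finset.sum_le_card_nsmul _ _ _ fun l _ => hΛ' l
      _ = q * Λ := by rw [hEcard, nsmul_eq_mul]
  have : FiniteDimensional 𝕜 (Submodule.span 𝕜 (e '' (G : Set ℕ))) :=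
    FiniteDimensional.span_of_finite 𝕜 (G.finite_toSet.image e)
  have : ProperSpace (Submodule.span 𝕜 (e '' (G : Set ℕ))) := FiniteDimensional.proper 𝕜 _
  set ρ := L * ‖w‖ + ‖w‖ + 2 * (β * (q * Λ)) with hρ
  have hcomp : IsCompact (((↑) : Submodule.span 𝕜 (e '' (G : Set ℕ)) → X) ''
      Metric.closedBall 0 ρ) :=
    (isCompact_closedBall 0 ρ).image continuous_subtype_val
  obtain ⟨i, j, hij, hle⟩ := exists_norm_sub_le_of_compact 𝕜 hcomp w hgb (y := y)
    (fun i j hij => by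
      refine ⟨⟨y i j, (hy i j hij).1⟩, ?_, rfl⟩
      rw [mem_closedBall_zero_iff, Submodule.coe_norm]
      have heq : y i j = w + (g i - g j) - (w - y i j + (g i - g j)) := by abel
      calc ‖y i j‖ = ‖w + (g i - g j) - (w - y i j + (g i - g j))‖ := by rw [← heq]
        _ ≤ ‖w + (g i - g j)‖ + ‖w - y i j + (g i - g j)‖ := norm_sub_le _ _
        _ ≤ ρ := by
          linarith [norm_add_le w (g i - g j), norm_sub_le (g i) (g j), hgb i, hgb j,
            (hy i j hij).2])
    (fun i j hij => (hy i j hij).2) hε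
  refine ⟨E i ∪ E j, η i, hcard i j hij, fun l hl => ?_, fun l _ => hη i l, ?_⟩
  · obtain ⟨n, hn, h⟩ := hDk i j l hl
    exact ⟨n, by omega, h⟩
  · rw [← hsum i j hij, norm_smul, RCLike.norm_ofReal, abs_of_pos hβ0] at hle
    calc α * ‖∑ l ∈ E i ∪ E j, η i l • e l‖
        = (1 + ε) / s * (β * ‖∑ l ∈ E i ∪ E j, η i l • e l‖) := by rw [hβdef]; field_simp
      _ ≤ _ := by gcongr

/-- Reduction of the disjoint Lebesgue-type estimate to bounds for far unimodular sums. -/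
theorem norm_sub_proj_le_of_limit (hb : IsMarkushevichBasis e f) {M : ℝ}
    (hfdsp : FDSP (𝕜 := 𝕜) e M) {s t : ℝ} (hs0 : 0 < s) (ht0 : 0 < t) {m : ℕ} {L : ℝ}
    (hL : 0 < L) (happrox : WeakSemiGreedyAt f s (2 * m) L) {x : X} {A : Finset ℕ}
    (hA : GreedySet f x m t A) {y : X} (hy : (msupp f y).Finite)
    (hym : (msupp f y).ncard ≤ m) (hyA : Disjoint (msupp f y) (A : Set ℕ)) {κ : ℝ} {H : ℝ → ℝ}
    (hHc : Continuous H) (hH0 : H 0 = κ * ‖x - y‖) (hκ : 0 ≤ κ)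
    (hH : ∀ α ε : ℝ, 0 < α → 0 < ε → (∀ i ∈ A, α ≤ ‖f i (x - y)‖) → ∀ k : ℕ → ℕ, StrictMono k →
      Separates 𝕜 e k (M + ε) → FarBound 𝕜 e k α (2 * m) (H ε)) :
    ‖x - proj e f A x‖ ≤ M * L * (1 + κ * (t⁻¹ * s⁻¹)) * ‖x - y‖ := by
  have hM := hfdsp.one_le hb
  have hnn : 0 ≤ M * L * (1 + κ * (t⁻¹ * s⁻¹)) * ‖x - y‖ := by positivity
  rcases A.eq_empty_or_nonempty with rfl | hne
  · have hm : m = 0 := by simpa using hA.1.symm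
    subst hm
    have hye : msupp f y = ∅ := (Set.ncard_eq_zero hy).mp (by omega)
    have hy0 : y = 0 := hb.total y fun i => by
      by_contra h
      exact (hye ▸ (show i ∈ msupp f y from h) : i ∈ (∅ : Set ℕ))
    obtain ⟨B, ⟨hB, -⟩, y', hy'B, hy'⟩ := happrox x
    have hB0 : B = ∅ := Finset.card_eq_zero.mp hB
    have hy'0 : y' = 0 := by
      rw [← hb.proj_eq_self hy'B, hB0]; simp [proj]
    have h := hy' y hy hym
    rw [hy'0, sub_zero] at h
    have h1 : proj e f ∅ x = 0 := by simp [proj]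
    rw [h1, sub_zero]
    have h2 : 0 ≤ κ * (t⁻¹ * s⁻¹) := by positivity
    have h3 : L ≤ M * L * (1 + κ * (t⁻¹ * s⁻¹)) := by
      nlinarith [mul_nonneg hL.le h2, mul_nonneg (sub_nonneg.mpr hM) hL.le,
        mul_nonneg (mul_nonneg (sub_nonneg.mpr hM) hL.le) h2]
    exact h.trans (by gcongr)
  obtain ⟨j₀, hj₀, hmin⟩ := A.exists_min_image (fun i => ‖f i x‖) hne
  have hxA : ∀ i ∉ A, t * ‖f i x‖ ≤ ‖f j₀ x‖ := fun i hi => hA.2 j₀ hj₀ i hi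
  rcases (norm_nonneg (f j₀ x)).eq_or_lt with h0 | hα
  · have h1 : x - proj e f A x = 0 := by
      refine hb.total _ fun i => ?_
      rw [map_sub, hb.coord_proj]
      split_ifs with hi
      · exact sub_self _
      · rw [sub_zero]
        have h2 := hxA i hi
        rw [← h0] at h2
        have h3 : ‖f i x‖ ≤ 0 := by
          by_contra! h4
          exact absurd h2 (not_le.mpr (mul_pos ht0 h4))
        exact norm_le_zero_iff.mp h3
    rwa [h1, norm_zero]
  have hwA : ∀ i ∈ A, ‖f j₀ x‖ ≤ ‖f i (x - y)‖ := by
    intro i hi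
    have h1 : f i y = 0 := by
      by_contra h
      exact Set.disjoint_left.mp hyA h hi
    rw [map_sub, h1, sub_zero]
    exact hmin i hi
  have hev : ∀ ε : ℝ, 0 < ε → ‖x - proj e f A x‖ ≤
      (M + ε) * L * (‖x - y‖ + (1 + ε) / (t * s) * H ε) := by
    intro ε hε
    obtain ⟨-, k, hk, hsep⟩ := hfdsp.exists_separates hb hε
    exact norm_sub_proj_le_of_farBound hb hs0 ht0 hL happrox hA.1 hα hxA hy hym hk
      (by linarith) hsep hε (hH _ ε hα hε hwA k hk hsep)
  have hcont : Continuous fun ε : ℝ =>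
      (M + ε) * L * (‖x - y‖ + (1 + ε) / (t * s) * H ε) := by fun_prop
  have hlim := (hcont.tendsto 0).mono_left (nhdsWithin_le_nhds (s := Set.Ioi (0 : ℝ)))
  have hfinal := ge_of_tendsto hlim (eventually_nhdsWithin_of_forall fun ε hε => hev ε hε)
  rw [hH0] at hfinal
  calc _ ≤ _ := hfinal
    _ = _ := by field_simp; ring

theorem norm_sub_proj_le_of_disjoint (hb : IsMarkushevichBasis e f) {M : ℝ}
    (hfdsp : FDSP (𝕜 := 𝕜) e M) {s t : ℝ} (hs0 : 0 < s) (ht0 : 0 < t) {m : ℕ} {L₁ L₂ : ℝ}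
    (hL₁ : 0 < L₁) (hL₂ : 0 < L₂) (happrox₁ : WeakSemiGreedyAt f s (2 * m) L₁)
    (happrox₂ : WeakSemiGreedyAt f s m L₂) {x : X} {A : Finset ℕ} (hA : GreedySet f x m t A)
    {y : X} (hy : (msupp f y).Finite) (hym : (msupp f y).ncard ≤ m)
    (hyA : Disjoint (msupp f y) (A : Set ℕ)) :
    ‖x - proj e f A x‖ ≤ M * L₁ * (1 + 2 * (M + 1) * L₂ * t⁻¹ * s⁻¹ ^ 2) * ‖x - y‖ := by
  have hM := hfdsp.one_le hb
  have h := norm_sub_proj_le_of_limit hb hfdsp hs0 ht0 hL₁ happrox₁ hA hy hym hyA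
    (κ := 2 * (M + 1) * L₂ * s⁻¹)
    (H := fun ε => (1 + ε) / s * ((1 + (M + ε)) * (L₂ * ‖x - y‖)) +
      (1 + ε) / s * ((1 + (M + ε)) * (L₂ * ‖x - y‖)))
    (by fun_prop) (by field_simp; ring) (by positivity)
    (fun α ε hα hε hwA k hk hsep => by
      have h := farBound_of_separates hb hs0 happrox₂ hA.1 hα hwA hk (by linarith) hsep hε
      rw [two_mul]
      exact h.add hk hα.le h)
  calc _ ≤ _ := h
    _ = _ := by ring

theorem norm_sub_proj_le_of_disjoint_of_ne_one (hb : IsMarkushevichBasis e f) {M : ℝ}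
    (hfdsp : FDSP (𝕜 := 𝕜) e M) {s t : ℝ} (hs0 : 0 < s) (ht0 : 0 < t) {m : ℕ} (hm : m ≠ 1)
    {L₁ L₂ : ℝ} (hL₁ : 0 < L₁) (hL₂ : 0 < L₂) (happrox₁ : WeakSemiGreedyAt f s (2 * m) L₁)
    (happrox₂ : WeakSemiGreedyAt f s m L₂) {x : X} {A : Finset ℕ} (hA : GreedySet f x m t A)
    {y : X} (hy : (msupp f y).Finite) (hym : (msupp f y).ncard ≤ m)
    (hyA : Disjoint (msupp f y) (A : Set ℕ)) :
    ‖x - proj e f A x‖ ≤ M * L₁ * (1 + 6 * L₂ * t⁻¹ * s⁻¹ ^ 2) * ‖x - y‖ := by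
  have h := norm_sub_proj_le_of_limit hb hfdsp hs0 ht0 hL₁ happrox₁ hA hy hym hyA
    (κ := 6 * L₂ * s⁻¹)
    (H := fun ε => (1 + ε) / s * (2 * (L₂ * ‖x - y‖) + ε) +
      (1 + ε) / s * (2 * (L₂ * ‖x - y‖) + ε) + (1 + ε) / s * (2 * (L₂ * ‖x - y‖) + ε))
    (by fun_prop) (by field_simp; ring) (by positivity)
    (fun α ε hα hε hwA k hk _ => by
      have h : ∀ q, 2 * q ≤ m → _ := fun q hq =>
        farBound_of_even hb hs0 happrox₂ hA.1 hα hwA hk hε hq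
      have hsum : 2 * m = 2 * (m / 2) + 2 * (m / 2) + 2 * (m % 2) := by omega
      rw [hsum]
      exact ((h _ (by omega)).add hk hα.le (h _ (by omega))).add hk hα.le (h _ (by omega)))
  calc _ ≤ _ := h
    _ = _ := by ring

theorem norm_sub_proj_le_of_card_eq_one (hb : IsMarkushevichBasis e f) {x : X} {a b : ℕ}
    (hab : a ≠ b) (hle : ‖f b x‖ ≤ ‖f a x‖) :
    ‖x - proj e f {a} x‖ ≤ (1 + (⨆ i, ‖e i‖) * (⨆ i, ‖f i‖) + (⨆ i, ‖e i‖ * ‖f i‖)) *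
      ‖x - proj e f {b} x‖ := by
  set u := x - proj e f {b} x with hu
  have hfu : f a u = f a x := by
    rw [hu, map_sub, hb.coord_proj, if_neg (by simpa using hab), sub_zero]
  have hE : ∀ i, ‖e i‖ ≤ ⨆ i, ‖e i‖ := fun i => le_ciSup hb.bddE i
  have hF : ∀ i, ‖f i‖ ≤ ⨆ i, ‖f i‖ := fun i => le_ciSup hb.bddF i
  have hE0 : 0 ≤ ⨆ i, ‖e i‖ := (norm_nonneg _).trans (hE 0)
  have hEF : ∀ i, ‖e i‖ * ‖f i‖ ≤ ⨆ i, ‖e i‖ * ‖f i‖ := fun i => by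
    refine le_ciSup (f := fun i => ‖e i‖ * ‖f i‖) ⟨(⨆ i, ‖e i‖) * ⨆ i, ‖f i‖, ?_⟩ i
    rintro _ ⟨j, rfl⟩
    exact mul_le_mul (hE j) (hF j) (norm_nonneg _) hE0
  have hfa : ‖f a x‖ ≤ ‖f a‖ * ‖u‖ := hfu ▸ (f a).le_opNorm u
  have heq : x - proj e f {a} x = u + f b x • e b - f a x • e a := by
    simp only [hu, proj, Finset.sum_singleton]; abel
  have h1 : ‖f b x • e b‖ ≤ (⨆ i, ‖e i‖) * (⨆ i, ‖f i‖) * ‖u‖ := by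
    rw [norm_smul]
    calc ‖f b x‖ * ‖e b‖ ≤ (‖f a‖ * ‖u‖) * ‖e b‖ := by gcongr; exact hle.trans hfa
      _ ≤ ((⨆ i, ‖f i‖) * ‖u‖) * ⨆ i, ‖e i‖ := by
          gcongr
          · exact mul_nonneg ((norm_nonneg _).trans (hF a)) (norm_nonneg _)
          · exact hF a
          · exact hE b
      _ = _ := by ring
  have h2 : ‖f a x • e a‖ ≤ (⨆ i, ‖e i‖ * ‖f i‖) * ‖u‖ := by
    rw [norm_smul]
    calc ‖f a x‖ * ‖e a‖ ≤ (‖f a‖ * ‖u‖) * ‖e a‖ := by gcongr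
      _ = (‖e a‖ * ‖f a‖) * ‖u‖ := by ring
      _ ≤ _ := by gcongr; exact hEF a
  rw [heq]
  linarith [norm_sub_le (u + f b x • e b) (f a x • e a), norm_add_le u (f b x • e b)]

/-- Estimates for disjoint sets of equal size transfer to arbitrary sets of equal size. -/
theorem norm_sub_proj_le_of_disjoint_sets (hb : IsMarkushevichBasis e f) {K : ℝ}
    (hK : ∀ (x : X) (m : ℕ) (A B : Finset ℕ), GreedySet f x m 1 A → B.card = m → Disjoint B A →
      ‖x - proj e f A x‖ ≤ K * ‖x - proj e f B x‖)
    {x : X} {m : ℕ} {A B : Finset ℕ} (hA : GreedySet f x m 1 A) (hB : B.card = m) :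
    ‖x - proj e f A x‖ ≤ K * ‖x - proj e f B x‖ := by
  set x' := x - proj e f (A ∩ B) x with hx'
  have hf : ∀ i, f i x' = if i ∈ A ∩ B then 0 else f i x := by
    intro i
    rw [hx', map_sub, hb.coord_proj]
    split_ifs <;> simp
  have hcA := Finset.card_sdiff_add_card_inter A B
  have hcB := Finset.card_sdiff_add_card_inter B A
  rw [Finset.inter_comm] at hcB
  have hA1 := hA.1
  have h := hK x' (A \ B).card (A \ B) (B \ A)
    ⟨rfl, fun j hj k hk => by
      rw [Finset.mem_sdiff] at hj hk
      rw [hf, hf, if_neg (fun h => hj.2 (Finset.mem_inter.mp h).2)]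
      split_ifs with h
      · simp
      · refine hA.2 j hj.1 k fun hkA => hk ⟨hkA, fun hkB => h (Finset.mem_inter.mpr ⟨hkA, hkB⟩)⟩⟩
    (by omega) disjoint_sdiff_sdiff
  have e1 : x' - proj e f (A \ B) x' = x - proj e f A x := by
    refine hb.ext fun i => ?_
    simp only [map_sub, hb.coord_proj, hf, Finset.mem_sdiff, Finset.mem_inter]
    split_ifs <;> simp_all
  have e2 : x' - proj e f (B \ A) x' = x - proj e f B x := by
    refine hb.ext fun i => ?_
    simp only [map_sub, hb.coord_proj, hf, Finset.mem_sdiff, Finset.mem_inter]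
    split_ifs <;> simp_all
  rwa [e1, e2] at h

theorem IsMarkushevichBasis.msupp_proj_subset (hb : IsMarkushevichBasis e f) (B : Finset ℕ)
    (x : X) : msupp f (proj e f B x) ⊆ (B : Set ℕ) := by
  intro i hi
  by_contra h
  apply hi
  rw [hb.coord_proj, if_neg (by simpa using h)]

end Auxiliary

/-- bounds for the disjoint Lebesgue parameter, and almost greediness of
weak semi-greedy bases. -/
theorem statement10 {𝕜 : Type*} [RCLike 𝕜] {X : Type*} [NormedAddCommGroup X]
    [NormedSpace 𝕜 X] [CompleteSpace X]
    (e : ℕ → X) (f : ℕ → X →L[𝕜] 𝕜) (hbasis : IsMarkushevichBasis e f)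
    (M : ℝ) (hfdsp : FDSP (𝕜 := 𝕜) e M)
    (s t : ℝ) (hs0 : 0 < s) (hs1 : s ≤ 1) (ht0 : 0 < t) (ht1 : t ≤ 1)
    (m : ℕ) (L₁ L₂ : ℝ) (hL₁ : 0 < L₁) (hL₂ : 0 < L₂)
    (happrox₁ : ∀ x : X, ∃ A : Finset ℕ, GreedySet f x (2 * m) s A ∧
      ∃ y : X, msupp f y ⊆ (A : Set ℕ) ∧
        ∀ z : X, (msupp f z).Finite → (msupp f z).ncard ≤ 2 * m → ‖x - y‖ ≤ L₁ * ‖x - z‖)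
    (happrox₂ : ∀ x : X, ∃ A : Finset ℕ, GreedySet f x m s A ∧
      ∃ y : X, msupp f y ⊆ (A : Set ℕ) ∧
        ∀ z : X, (msupp f z).Finite → (msupp f z).ncard ≤ m → ‖x - y‖ ≤ L₂ * ‖x - z‖) :
    (∀ (x : X) (A : Finset ℕ), GreedySet f x m t A →
      ∀ y : X, (msupp f y).Finite → (msupp f y).ncard ≤ m →
        Disjoint (msupp f y) (A : Set ℕ) →
        ‖x - proj e f A x‖ ≤ M * L₁ * (1 + 2 * (M + 1) * L₂ * t⁻¹ * s⁻¹ ^ 2) * ‖x - y‖) ∧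
    (∀ C : ℝ, 0 < C →
      (∀ (x : X) (m' : ℕ), ∃ A : Finset ℕ, GreedySet f x m' s A ∧
        ∃ y : X, msupp f y ⊆ (A : Set ℕ) ∧
          ∀ z : X, (msupp f z).Finite → (msupp f z).ncard ≤ m' → ‖x - y‖ ≤ C * ‖x - z‖) →
      ∃ K : ℝ, K ≤ min (M * C * (1 + 2 * C * (M + 1) * s⁻¹ ^ 2))
          (max (M * C * (1 + 6 * C * s⁻¹ ^ 2))
            (1 + (⨆ i, ‖e i‖) * (⨆ i, ‖f i‖) + (⨆ i, ‖e i‖ * ‖f i‖))) ∧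
        ∀ (x : X) (m' : ℕ) (A : Finset ℕ), GreedySet f x m' 1 A →
          ∀ B : Finset ℕ, B.card = m' →
            ‖x - proj e f A x‖ ≤ K * ‖x - proj e f B x‖) := by
  refine ⟨fun x A hA y hy hym hyA => norm_sub_proj_le_of_disjoint hbasis hfdsp hs0 ht0 hL₁ hL₂
    happrox₁ happrox₂ hA hy hym hyA, fun C hC happrox => ⟨_, le_rfl, fun x m' A hA B hB => ?_⟩⟩
  have happrox' : ∀ n, WeakSemiGreedyAt f s n C := fun n x => happrox x n
  refine norm_sub_proj_le_of_disjoint_sets hbasis (fun x m' A B hA hB hBA => ?_) hA hB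
  have hsub := hbasis.msupp_proj_subset B x
  have hfin : (msupp f (proj e f B x)).Finite := B.finite_toSet.subset hsub
  have hcard : (msupp f (proj e f B x)).ncard ≤ m' := by
    rw [← hB, ← Set.ncard_coe_finset]
    exact Set.ncard_le_ncard hsub B.finite_toSet
  have hdisj : Disjoint (msupp f (proj e f B x)) (A : Set ℕ) :=
    (Finset.disjoint_coe.mpr hBA).mono_left hsub
  rw [min_mul_of_nonneg _ _ (norm_nonneg _), max_mul_of_nonneg _ _ (norm_nonneg _)]
  refine le_min ?_ ?_
  · have h := norm_sub_proj_le_of_disjoint hbasis hfdsp hs0 one_pos hC hC (happrox' _)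
      (happrox' _) hA hfin hcard hdisj
    calc _ ≤ _ := h
      _ = _ := by ring
  · by_cases hm : m' = 1
    · subst hm
      obtain ⟨a, rfl⟩ := Finset.card_eq_one.mp hA.1
      obtain ⟨b, rfl⟩ := Finset.card_eq_one.mp hB
      have hab : b ≠ a := by simpa using hBA
      refine le_max_of_le_right (norm_sub_proj_le_of_card_eq_one hbasis hab.symm ?_)
      simpa using hA.2 a (by simp) b (by simpa using hab)
    · have h := norm_sub_proj_le_of_disjoint_of_ne_one hbasis hfdsp hs0 one_pos hm hC hC
        (happrox' _) (happrox' _) hA hfin hcard hdisj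
      refine le_max_of_le_left ?_
      calc _ ≤ _ := h
        _ = _ := by ring

end GreedyPaper
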